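/- For every integer n ≥ 230, the diameter of the Fibonacci-run graph satisfies diam(R_n) > n − ⌊√(1 + n/2) − 3/4⌋; in particular the conjectured formula diam(R_n) = n − ⌊√(1 + n/2) − 3/4⌋ fails for all n ≥ 230. -/

import Mathlib

/-- Run-constrained binary strings: every maximal run of `1`s is immediately
followed by a strictly longer run of `0`s. -/
inductive RunConstrained : List Bool → Prop
  | nil : RunConstrained []
  | zero {l : List Bool} : RunConstrained l → RunConstrained (false :: l)
  | block {l : List Bool} (r s : ℕ) (hr : 1 ≤ r) (hs : r < s) :
      RunConstrained l →
      RunConstrained (List.replicate r true ++ List.replicate s false ++ l)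

/-- Hamming distance between two binary strings (of the same length). -/
def hammingD (α β : List Bool) : ℕ := (List.zipWith bne α β).count true

/-- The Fibonacci-run graph `R n`: vertices are strings `r` of length `n` with
`r00` run-constrained; two vertices are adjacent iff they differ in exactly one
coordinate. -/
noncomputable def fibRunGraph (n : ℕ) :
    SimpleGraph {l : List Bool // l.length = n ∧ RunConstrained (l ++ [false, false])} :=
  SimpleGraph.fromRel fun a b => hammingD a.1 b.1 = 1

namespace RunConstrained

theorem tail {l : List Bool} (h : RunConstrained l) : RunConstrained l.tail := by
  cases h with
  | nil => exact .nil
  | zero h => exact h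
  | block r s hr hs h =>
    obtain ⟨r, rfl⟩ := Nat.exists_eq_add_of_le' hr
    rcases Nat.eq_zero_or_pos r with rfl | hr'
    · have hz : ∀ s, RunConstrained (List.replicate s false ++ _) := fun s => by
        induction s with
        | zero => exact h
        | succ s ih => exact .zero ih
      simpa [List.replicate_succ] using hz s
    · simpa [List.replicate_succ] using RunConstrained.block r s hr' (by omega) h

theorem drop {l : List Bool} (h : RunConstrained l) (i : ℕ) : RunConstrained (l.drop i) := by
  induction i with
  | zero => simpa using h
  | succ i ih => simpa using ih.tail

theorem zeros {l : List Bool} (h : RunConstrained l) (s : ℕ) :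
    RunConstrained (List.replicate s false ++ l) := by
  induction s with
  | zero => exact h
  | succ s ih => exact .zero ih

theorem ones_zeros {l : List Bool} (h : RunConstrained l) {r s : ℕ} (hrs : r < s) :
    RunConstrained (List.replicate r true ++ (List.replicate s false ++ l)) := by
  rcases Nat.eq_zero_or_pos r with rfl | hr
  · exact h.zeros s
  · simpa using RunConstrained.block r s hr hrs h

/-- A run-constrained string does not start with `101`. -/
theorem head_not_101 {x : Bool} {l : List Bool} (h : RunConstrained (true :: false :: x :: l)) :
    x = false := by
  generalize hw : true :: false :: x :: l = w at h
  cases h with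
  | nil => simp at hw
  | zero h => simp at hw
  | block r s hr hs h =>
    obtain ⟨r, rfl⟩ := Nat.exists_eq_add_of_le' hr
    obtain ⟨s, rfl⟩ := Nat.exists_eq_add_of_le' (show 2 ≤ s by omega)
    rcases r with _ | r
    · simp [List.replicate_succ] at hw
      exact hw.1
    · simp [List.replicate_succ] at hw

/-- A run-constrained string does not contain `101`. -/
theorem not_101 {l : List Bool} (h : RunConstrained (l ++ [false, false])) {i : ℕ}
    (h0 : l.getD i false = true) (h1 : l.getD (i + 1) false = false) :
    l.getD (i + 2) false = false := by
  by_cases hi : i + 2 < l.length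
  · have hd := h.drop i
    rw [List.drop_append_of_le_length (by omega), List.drop_eq_getElem_cons (by omega),
      List.drop_eq_getElem_cons (i := i + 1) (by omega),
      List.drop_eq_getElem_cons (i := i + 1 + 1) (by omega)] at hd
    rw [List.getD_eq_getElem _ _ (by omega)] at h0 h1 ⊢
    rw [h0, h1] at hd
    exact hd.head_not_101
  · exact List.getD_eq_default _ _ (by omega)

end RunConstrained

section Hamming

@[simp] theorem hammingD_nil : hammingD [] [] = 0 := rfl

@[simp] theorem hammingD_cons (a b : Bool) (α β : List Bool) :
    hammingD (a :: α) (b :: β) = hammingD α β + if a = b then 0 else 1 := by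
  cases a <;> cases b <;> simp [hammingD]

theorem hammingD_comm (α β : List Bool) : hammingD α β = hammingD β α := by
  unfold hammingD
  rw [List.zipWith_comm]
  congr 2
  funext a b
  exact bne_comm

theorem hammingD_append {α β : List Bool} (h : α.length = β.length) (γ δ : List Bool) :
    hammingD (α ++ γ) (β ++ δ) = hammingD α β + hammingD γ δ := by
  simp [hammingD, List.zipWith_append h]

@[simp] theorem hammingD_self (α : List Bool) : hammingD α α = 0 := by
  induction α with
  | nil => rfl
  | cons a α ih => simp [ih]

theorem hammingD_replicate_not (s : ℕ) (b : Bool) :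
    hammingD (List.replicate s b) (List.replicate s !b) = s := by
  induction s with
  | zero => rfl
  | succ s ih => simp [List.replicate_succ, ih]

theorem eq_of_hammingD_eq_zero {α β : List Bool} (hl : α.length = β.length)
    (h : hammingD α β = 0) : α = β := by
  induction α generalizing β with
  | nil => simpa [eq_comm] using hl
  | cons a α ih =>
    cases β with
    | nil => simp at hl
    | cons b β =>
      simp at hl h
      rw [h.2, ih hl h.1]

/-- Strings at Hamming distance one differ in a single coordinate `q`, which accounts for the
difference between their Hamming distances to any third string. -/
theorem exists_flip_of_hammingD_eq_one {α β v : List Bool} (hαβ : α.length = β.length)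
    (hαv : α.length = v.length) (h : hammingD α β = 1) :
    ∃ q, (α.getD q false ≠ β.getD q false) ∧
      (∀ i, i ≠ q → α.getD i false = β.getD i false) ∧
      (hammingD α v + (if β.getD q false = v.getD q false then 0 else 1) =
        hammingD β v + if α.getD q false = v.getD q false then 0 else 1) := by
  induction α generalizing β v with
  | nil =>
    obtain rfl : β = [] := by simpa [eq_comm] using hαβ
    simp at h
  | cons a α ih =>
    obtain _ | ⟨b, β⟩ := β
    · simp at hαβ
    obtain _ | ⟨x, v⟩ := v
    · simp at hαv
    simp only [List.length_cons, add_left_inj] at hαβ hαv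
    by_cases hab : a = b
    · obtain ⟨q, h1, h2, h3⟩ := ih hαβ hαv (by simpa [hab] using h)
      refine ⟨q + 1, by simpa using h1, fun i hi => ?_, ?_⟩
      · cases i with
        | zero => simpa using hab
        | succ i => simpa using h2 i (by omega)
      · simp only [hammingD_cons, List.getD_cons_succ, hab]
        omega
    · obtain rfl := eq_of_hammingD_eq_zero hαβ (by simpa [hab] using h)
      refine ⟨0, by simpa using hab, fun i hi => ?_, ?_⟩
      · cases i with
        | zero => exact absurd rfl hi
        | succ i => simp
      · simp only [hammingD_cons, List.getD_cons_zero]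
        omega

end Hamming

section Potential

/-- The number of `i < j` such that coordinates `3i, …, 3i+3` of the string are all `1`. -/
def fourBlocks (j : ℕ) (w : List Bool) : ℕ :=
  ∑ i ∈ Finset.range j,
    if w.getD (3 * i) false = true ∧ w.getD (3 * i + 1) false = true ∧
      w.getD (3 * i + 2) false = true ∧ w.getD (3 * i + 3) false = true then 1 else 0

theorem sum_ite_eq_three_mul (j q : ℕ) :
    (∑ i ∈ Finset.range j, if q = 3 * i then 1 else 0) =
      if q % 3 = 0 ∧ q / 3 < j then 1 else 0 := by
  induction j with
  | zero => simp
  | succ j ih =>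
    rw [Finset.sum_range_succ, ih]
    split_ifs <;> omega

theorem sum_ite_eq_three_mul_add_three (j q : ℕ) :
    (∑ i ∈ Finset.range j, if q = 3 * i + 3 then 1 else 0) =
      if q % 3 = 0 ∧ 0 < q ∧ q / 3 ≤ j then 1 else 0 := by
  induction j with
  | zero => simp; omega
  | succ j ih =>
    rw [Finset.sum_range_succ, ih]
    split_ifs <;> omega

variable {j q : ℕ} {w w' : List Bool}

theorem fourBlocks_mono (hw' : w'.getD q false = false)
    (heq : ∀ i, i ≠ q → w.getD i false = w'.getD i false) :
    fourBlocks j w' ≤ fourBlocks j w := by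
  have key : ∀ i, w'.getD i false = true → w.getD i false = true := fun i hi => by
    by_cases hiq : i = q
    · rw [hiq, hw'] at hi
      exact absurd hi Bool.false_ne_true
    · rw [heq i hiq, hi]
  refine Finset.sum_le_sum fun i _ => ?_
  split_ifs with h1 h2
  · exact le_rfl
  · exact absurd ⟨key _ h1.1, key _ h1.2.1, key _ h1.2.2.1, key _ h1.2.2.2⟩ h2
  · exact Nat.zero_le _
  · exact le_rfl

/-- Filling coordinate `q` creates at most one block, and none unless `q` is one of the
coordinates `0, 3, …, 3j`. -/
theorem fourBlocks_le (hrc : RunConstrained (w' ++ [false, false]))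
    (hw' : w'.getD q false = false)
    (heq : ∀ i, i ≠ q → w.getD i false = w'.getD i false) :
    fourBlocks j w ≤ fourBlocks j w' + if q % 3 = 0 ∧ q / 3 ≤ j then 1 else 0 := by
  have no101 : ∀ i, i + 1 = q → w.getD i false = true →
      w.getD (i + 2) false = true → False := by
    rintro i rfl h0 h2
    rw [heq _ (by omega)] at h0 h2
    rw [hrc.not_101 h0 hw'] at h2
    exact Bool.false_ne_true h2
  unfold fourBlocks
  by_cases hq : w.getD (q + 1) false = true
  · refine le_trans (b := (∑ i ∈ Finset.range j, _) +
      ∑ i ∈ Finset.range j, if q = 3 * i then 1 else 0) ?_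
      (Nat.add_le_add_left ?_ _)
    · rw [← Finset.sum_add_distrib]
      refine Finset.sum_le_sum fun i _ => ?_
      by_cases hqi : q = 3 * i
      · rw [if_pos hqi]; split_ifs <;> omega
      · by_cases hb : w.getD (3 * i) false = true ∧ w.getD (3 * i + 1) false = true ∧
          w.getD (3 * i + 2) false = true ∧ w.getD (3 * i + 3) false = true
        · have h1 : 3 * i + 1 ≠ q := fun h => no101 _ h hb.1 hb.2.2.1
          have h2 : 3 * i + 2 ≠ q := fun h => no101 _ h hb.2.1 hb.2.2.2
          have h3 : 3 * i + 3 ≠ q := fun h => no101 _ h hb.2.2.1 (by subst h; exact hq)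
          have hb' := hb
          rw [heq _ (Ne.symm hqi), heq _ h1, heq _ h2, heq _ h3] at hb'
          rw [if_pos hb, if_pos hb']
          omega
        · rw [if_neg hb]; omega
    · rw [sum_ite_eq_three_mul]
      split_ifs <;> omega
  · refine le_trans (b := (∑ i ∈ Finset.range j, _) +
      ∑ i ∈ Finset.range j, if q = 3 * i + 3 then 1 else 0) ?_
      (Nat.add_le_add_left ?_ _)
    · rw [← Finset.sum_add_distrib]
      refine Finset.sum_le_sum fun i _ => ?_
      by_cases hqi : q = 3 * i + 3
      · rw [if_pos hqi]; split_ifs <;> omega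
      · by_cases hb : w.getD (3 * i) false = true ∧ w.getD (3 * i + 1) false = true ∧
          w.getD (3 * i + 2) false = true ∧ w.getD (3 * i + 3) false = true
        · have h0 : 3 * i ≠ q := fun h => hq (h ▸ hb.2.1)
          have h1 : 3 * i + 1 ≠ q := fun h => hq (h ▸ hb.2.2.1)
          have h2 : 3 * i + 2 ≠ q := fun h => hq (h ▸ hb.2.2.2)
          have hb' := hb
          rw [heq _ h0, heq _ h1, heq _ h2, heq _ (Ne.symm hqi)] at hb'
          rw [if_pos hb, if_pos hb']
          omega
        · rw [if_neg hb]; omega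
    · rw [sum_ite_eq_three_mul_add_three]
      split_ifs <;> omega

/-- If the target `v` has `1`s in coordinates `0, 3, …, 3j`, then the Hamming distance to `v`
plus twice the number of blocks changes by at most one along an edge. -/
theorem hammingD_add_fourBlocks_le {v : List Bool} (hv : ∀ i ≤ j, v.getD (3 * i) false = true)
    (hl : w.length = w'.length) (hlv : w.length = v.length)
    (hrc : RunConstrained (w' ++ [false, false]))
    (h : hammingD w w' = 1) :
    hammingD w v + 2 * fourBlocks j w ≤ hammingD w' v + 2 * fourBlocks j w' + 1 := by
  obtain ⟨q, hne, heq, hham⟩ := exists_flip_of_hammingD_eq_one hl hlv h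
  have hvq : q % 3 = 0 ∧ q / 3 ≤ j → v.getD q false = true := fun hq => by
    have := hv (q / 3) hq.2
    rwa [show 3 * (q / 3) = q by omega] at this
  cases hw : w.getD q false
  · have hw' : w'.getD q false = true :=
      Bool.eq_true_of_not_eq_false fun h => hne (hw.trans h.symm)
    have := fourBlocks_mono (j := j) hw fun i hi => (heq i hi).symm
    rw [hw, hw'] at hham
    split_ifs at hham <;> omega
  · have hw' : w'.getD q false = false :=
      Bool.eq_false_of_not_eq_true fun h => hne (hw.trans h.symm)
    have := fourBlocks_le (j := j) hrc hw' heq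
    rw [hw, hw'] at hham
    by_cases hq : q % 3 = 0 ∧ q / 3 ≤ j
    · rw [hvq hq] at hham
      simp only [hq, and_self, if_true, Bool.false_eq_true, if_false] at hham this
      omega
    · simp only [hq, if_false] at this
      split_ifs at hham <;> omega

end Potential

section Graph

variable {n : ℕ}

theorem fibRunGraph_adj_iff (a b : {l : List Bool // l.length = n ∧
    RunConstrained (l ++ [false, false])}) :
    (fibRunGraph n).Adj a b ↔ hammingD a.1 b.1 = 1 := by
  simp only [fibRunGraph, SimpleGraph.fromRel_adj, hammingD_comm b.1 a.1, or_self, ne_eq,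
    and_iff_right_iff_imp]
  rintro h rfl
  simp at h

theorem replicate_false_append_drop (w : List Bool) (h : RunConstrained (w ++ [false, false]))
    (k : ℕ) (hk : k ≤ w.length) :
    RunConstrained (List.replicate k false ++ w.drop k ++ [false, false]) := by
  rw [List.append_assoc, ← List.drop_append_of_le_length hk]
  exact (h.drop k).zeros k

theorem fibRunGraph_reachable_zero (a : {l : List Bool // l.length = n ∧
    RunConstrained (l ++ [false, false])}) (k : ℕ) (hk : k ≤ n) :
    (fibRunGraph n).Reachable a
      ⟨List.replicate k false ++ a.1.drop k, by simp [a.2.1, hk],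
        replicate_false_append_drop _ a.2.2 k (by rw [a.2.1]; exact hk)⟩ := by
  induction k with
  | zero => simp
  | succ k ih =>
    refine (ih (by omega)).trans ?_
    have hlt : k < a.1.length := by rw [a.2.1]; omega
    have hd := List.drop_eq_getElem_cons hlt
    by_cases hak : a.1[k] = false
    · convert SimpleGraph.Reachable.refl _ using 2
      rw [hd, hak, List.replicate_succ', List.append_assoc]
      rfl
    · refine SimpleGraph.Adj.reachable ((fibRunGraph_adj_iff _ _).2 ?_)
      simp only
      rw [hd, List.replicate_succ', List.append_assoc, hammingD_append rfl]
      simp [hak]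

instance finite_vertices : Finite {l : List Bool // l.length = n ∧
    RunConstrained (l ++ [false, false])} :=
  ((List.finite_length_eq Bool n).subset fun _ h => h.1).to_subtype

theorem fibRunGraph_preconnected : (fibRunGraph n).Preconnected := fun a b => by
  have ha := fibRunGraph_reachable_zero a n le_rfl
  have hb := fibRunGraph_reachable_zero b n le_rfl
  refine ha.trans ?_
  convert hb.symm using 3
  rw [List.drop_eq_nil_of_le a.2.1.le, List.drop_eq_nil_of_le b.2.1.le]

theorem le_diam_fibRunGraph (j : ℕ) (a b : {l : List Bool // l.length = n ∧
    RunConstrained (l ++ [false, false])})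
    (hb : ∀ i ≤ j, b.1.getD (3 * i) false = true) :
    hammingD a.1 b.1 + 2 * fourBlocks j a.1 ≤
      (fibRunGraph n).diam + 2 * fourBlocks j b.1 := by
  have hwalk : ∀ w, (p : (fibRunGraph n).Walk w b) →
      hammingD w.1 b.1 + 2 * fourBlocks j w.1 ≤ p.length + 2 * fourBlocks j b.1 := by
    intro w p
    induction p with
    | nil => simp
    | cons hadj p ih =>
      rename_i x y z
      have := hammingD_add_fourBlocks_le hb (x.2.1.trans y.2.1.symm) (x.2.1.trans z.2.1.symm)
        y.2.2 ((fibRunGraph_adj_iff _ _).1 hadj)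
      have := ih hb
      simp only [SimpleGraph.Walk.length_cons]
      omega
  have : Nonempty {l : List Bool // l.length = n ∧
    RunConstrained (l ++ [false, false])} := ⟨a⟩
  have hconn : (fibRunGraph n).Connected := ⟨fibRunGraph_preconnected⟩
  obtain ⟨p, hp⟩ := hconn.exists_walk_length_eq_dist a b
  have hdist : (fibRunGraph n).dist a b ≤ (fibRunGraph n).diam :=
    SimpleGraph.dist_le_diam (SimpleGraph.connected_iff_ediam_ne_top.1 hconn)
  have := hwalk a p
  omega

end Graph

section Construction

/-- A pair of strings of length `ℓ` agreeing in at most `c` coordinates, each a valid end of a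
vertex, the first of which may be preceded by any run of fewer than `h` ones. -/
def TailPair (c h ℓ : ℕ) : Prop :=
  ∃ p q : List Bool, p.length = ℓ ∧ q.length = ℓ ∧
    (∀ r < h, RunConstrained (List.replicate r true ++ (p ++ [false, false]))) ∧
    RunConstrained (q ++ [false, false]) ∧ ℓ ≤ hammingD p q + c

namespace TailPair

variable {c h ℓ : ℕ}

theorem base (c : ℕ) : TailPair c (2 * c + 3) (2 * c + 1) := by
  have hnil : RunConstrained [] := .nil
  refine ⟨List.replicate (c + 1) false ++ List.replicate c false,
    List.replicate (c + 1) true ++ List.replicate c false, by simp; omega, by simp; omega,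
    fun r hr => ?_, ?_, ?_⟩
  · have := hnil.ones_zeros hr
    rwa [List.append_nil, show 2 * c + 3 = c + 1 + c + 2 by omega, List.replicate_add,
      List.replicate_add] at this
  · have := hnil.ones_zeros (show c + 1 < c + 2 by omega)
    rw [List.append_nil, List.replicate_add c 2] at this
    simpa using this
  · rw [hammingD_append (by simp), show true = !false from rfl, hammingD_replicate_not]
    omega

theorem step (ht : TailPair c h ℓ) {x : ℕ} (hx : x < h) : TailPair c x (ℓ + x) := by
  obtain ⟨p, q, hp, hq, hrp, hrq, hham⟩ := ht
  refine ⟨List.replicate x false ++ q, List.replicate x true ++ p, by simp; omega,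
    by simp; omega, fun r hr => ?_, ?_, ?_⟩
  · rw [List.append_assoc]
    exact hrq.ones_zeros hr
  · rw [List.append_assoc]
    exact hrp x hx
  · rw [hammingD_append (by simp), show true = !false from rfl, hammingD_replicate_not,
      hammingD_comm]
    omega

/-- Prepending `k` runs with distinct lengths in `[lo, h)`: every total length between the two
extreme ones is possible. -/
theorem steps {lo k s : ℕ} (ht : TailPair c h ℓ) (hk : lo + k ≤ h)
    (hmin : k * (2 * lo + k) ≤ 2 * s + k) (hmax : 2 * s + k * (k + 1) ≤ 2 * k * h) :
    ∃ h', lo ≤ h' ∧ TailPair c h' (ℓ + s) := by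
  induction k generalizing h ℓ s with
  | zero =>
    obtain rfl : s = 0 := by omega
    exact ⟨h, by omega, ht⟩
  | succ k ih =>
    obtain ⟨h, rfl⟩ : ∃ h₀, h = h₀ + 1 := ⟨h - 1, by omega⟩
    by_cases hs : k * (2 * lo + k) + 2 * h ≤ 2 * s + k
    · have hhs : h ≤ s := by
        have : k ≤ k * (2 * lo + k) := by nlinarith [Nat.le_mul_self k, Nat.zero_le (k * lo)]
        omega
      obtain ⟨s, rfl⟩ := Nat.exists_eq_add_of_le hhs
      have := ih (ht.step (Nat.lt_succ_self h)) (s := s) (by omega) (by omega) (by nlinarith)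
      simpa only [add_assoc] using this
    · obtain ⟨t, ht2⟩ : ∃ t, 2 * t + k = k * (2 * lo + k) := by
        obtain ⟨e, he⟩ := Nat.even_mul_succ_self k
        refine ⟨k * lo + e - k, ?_⟩
        have : k ≤ e := by
          rcases k with _ | k
          · omega
          · nlinarith
        zify [show k ≤ k * lo + e by omega]
        zify at he
        linarith
      have hts : t + (lo + k) ≤ s := by nlinarith
      obtain ⟨x, rfl⟩ := Nat.exists_eq_add_of_le' (show t ≤ s by omega)
      have := ih (ht.step (x := x) (by omega)) (s := t) (by omega) (by omega) (by nlinarith)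
      simpa only [add_assoc] using this

end TailPair

/-- The string `(100)^j`. -/
def comb : ℕ → List Bool
  | 0 => []
  | j + 1 => true :: false :: false :: comb j

theorem length_comb (j : ℕ) : (comb j).length = 3 * j := by
  induction j with
  | zero => rfl
  | succ j ih => simp [comb, ih]; omega

theorem RunConstrained.comb_append {l : List Bool} (h : RunConstrained l) (j : ℕ) :
    RunConstrained (comb j ++ l) := by
  induction j with
  | zero => exact h
  | succ j ih => simpa [List.replicate, comb] using RunConstrained.block 1 2 le_rfl (by omega) ih

theorem hammingD_ones_comb (j : ℕ) :
    hammingD (List.replicate (3 * j) true) (comb j) = 2 * j := by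
  induction j with
  | zero => rfl
  | succ j ih =>
    simp [show 3 * (j + 1) = 3 * j + 1 + 1 + 1 by omega, List.replicate_succ, comb, ih]
    omega

theorem getD_comb_append_three_mul (l : List Bool) {i j : ℕ} (hij : i ≤ j) :
    (comb j ++ true :: l).getD (3 * i) false = true := by
  induction j generalizing i with
  | zero =>
    obtain rfl : i = 0 := by omega
    simp [comb]
  | succ j ih =>
    cases i with
    | zero => simp [comb]
    | succ i =>
      simpa [comb, show 3 * (i + 1) = 3 * i + 1 + 1 + 1 by omega] using
        ih (i := i) (by omega)

theorem getD_comb_append_three_mul_add_one (l : List Bool) {i j : ℕ} (hij : i < j) :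
    (comb j ++ l).getD (3 * i + 1) false = false := by
  induction j generalizing i with
  | zero => omega
  | succ j ih =>
    cases i with
    | zero => simp [comb]
    | succ i =>
      simpa [comb, show 3 * (i + 1) + 1 = 3 * i + 1 + 1 + 1 + 1 by omega] using
        ih (i := i) (by omega)

theorem fourBlocks_comb_append (j : ℕ) (l : List Bool) : fourBlocks j (comb j ++ l) = 0 := by
  refine Finset.sum_eq_zero fun i hi => if_neg fun h => ?_
  have := getD_comb_append_three_mul_add_one l (Finset.mem_range.1 hi)
  rw [h.2.1] at this
  exact absurd this (by simp)

theorem fourBlocks_ones_append (j : ℕ) (l : List Bool) :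
    fourBlocks j (List.replicate (3 * j + 1) true ++ l) = j := by
  have hone : ∀ i < 3 * j + 1, (List.replicate (3 * j + 1) true ++ l).getD i false = true :=
    fun i hi => by
      rw [List.getD_append _ _ _ _ (by simpa using hi)]
      simp [hi]
  unfold fourBlocks
  rw [Finset.sum_congr rfl (g := fun _ => 1)]
  · simp
  · intro i hi
    rw [Finset.mem_range] at hi
    exact if_pos ⟨hone _ (by omega), hone _ (by omega), hone _ (by omega), hone _ (by omega)⟩

theorem TailPair.le_diam {c h ℓ : ℕ} (ht : TailPair c h ℓ) (j : ℕ) (hj : 3 * j + 4 ≤ h) :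
    ℓ + 7 * j + 2 ≤ (fibRunGraph (ℓ + 6 * j + 3)).diam + c := by
  obtain ⟨p, q, hp, hq, hrp, hrq, hham⟩ := ht
  let u := List.replicate (3 * j + 1) true ++ (List.replicate (3 * j + 2) false ++ q)
  let v := comb j ++ true :: (List.replicate (3 * j + 2) true ++ p)
  have hu : u.length = ℓ + 6 * j + 3 := by simp [u]; omega
  have hv : v.length = ℓ + 6 * j + 3 := by simp [v, length_comb]; omega
  have hru : RunConstrained (u ++ [false, false]) := by
    have := hrq.ones_zeros (show 3 * j + 1 < 3 * j + 2 by omega)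
    simpa [u] using this
  have hrv : RunConstrained (v ++ [false, false]) := by
    have := (hrp (3 * j + 3) (by omega)).comb_append j
    simpa [v, List.replicate_succ] using this
  have key := le_diam_fibRunGraph j ⟨u, hu, hru⟩ ⟨v, hv, hrv⟩
    fun i hi => getD_comb_append_three_mul _ hi
  have hd : hammingD u v = 2 * j + (3 * j + 2) + hammingD p q := by
    simp only [u, v]
    rw [List.replicate_succ', List.append_assoc, hammingD_append (by simp [length_comb]),
      hammingD_ones_comb, List.singleton_append, hammingD_cons, hammingD_append (by simp),
      show true = !false from rfl, hammingD_replicate_not, hammingD_comm q p]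
    simp
    omega
  simp only [hd] at key
  rw [fourBlocks_ones_append, fourBlocks_comb_append] at key
  omega

/-- The diameter bound from `k` runs with lengths in `[3j+4, 2c+2]`, of total length `s`. -/
theorem le_diam_of_runs {n : ℕ} (j c k s : ℕ) (hn : n = 2 * c + 1 + s + 6 * j + 3)
    (hk : 3 * j + 4 + k ≤ 2 * c + 3) (hmin : k * (2 * (3 * j + 4) + k) ≤ 2 * s + k)
    (hmax : 2 * s + k * (k + 1) ≤ 2 * k * (2 * c + 3)) :
    n + j ≤ (fibRunGraph n).diam + c + 1 := by
  obtain ⟨h', hh', ht⟩ := (TailPair.base c).steps hk hmin hmax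
  have := ht.le_diam j hh'
  subst hn
  omega

theorem lt_diam_add {n m : ℕ} (hm : 10 ≤ m) (hlo : 2 * m ^ 2 + 3 * m ≤ n)
    (hhi : n ≤ 2 * m ^ 2 + 7 * m + 4) : n < (fibRunGraph n).diam + m := by
  have four : ∀ k s, n = 2 * (m + 2) + 1 + s + 6 * 4 + 3 → 16 + k ≤ 2 * (m + 2) + 3 →
      k * (32 + k) ≤ 2 * s + k → 2 * s + k * (k + 1) ≤ 2 * k * (2 * (m + 2) + 3) →
      n < (fibRunGraph n).diam + m := fun k s h1 h2 h3 h4 => by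
    have := le_diam_of_runs 4 (m + 2) k s h1 h2 h3 h4
    omega
  have five : ∀ k s, n = 2 * (m + 3) + 1 + s + 6 * 5 + 3 → 19 + k ≤ 2 * (m + 3) + 3 →
      k * (38 + k) ≤ 2 * s + k → 2 * s + k * (k + 1) ≤ 2 * k * (2 * (m + 3) + 3) →
      n < (fibRunGraph n).diam + m := fun k s h1 h2 h3 h4 => by
    have := le_diam_of_runs 5 (m + 3) k s h1 h2 h3 h4
    omega
  by_cases hm13 : 13 ≤ m
  · obtain ⟨t, rfl⟩ := Nat.exists_eq_add_of_le hm13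
    ring_nf at hlo hhi
    obtain ⟨s, rfl⟩ : ∃ s, n = 2 * (13 + t + 2) + 1 + s + 6 * 4 + 3 :=
      ⟨n - (2 * (13 + t + 2) + 1 + 6 * 4 + 3), by omega⟩
    rcases le_or_gt (2 * t ^ 2 + 61 * t + 345) s with h2 | h2
    · refine four (2 * t + 15) s rfl (by omega) ?_ ?_ <;> ring_nf <;> omega
    rcases le_or_gt (2 * t ^ 2 + 59 * t + 315) s with h3 | h3
    · refine four (2 * t + 14) s rfl (by omega) ?_ ?_ <;> ring_nf <;> omega
    rcases le_or_gt (2 * t ^ 2 + 55 * t + 258) s with h5 | h5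
    · refine four (2 * t + 12) s rfl (by omega) ?_ ?_ <;> ring_nf <;> omega
    · refine four (2 * t + 11) s rfl (by omega) ?_ ?_ <;> ring_nf <;> omega
  · obtain rfl | rfl | rfl : m = 10 ∨ m = 11 ∨ m = 12 := by omega
    · by_cases h1 : n ≤ 231
      · exact four 8 (n - 52) (by omega) (by omega) (by omega) (by omega)
      by_cases h2 : n ≤ 250
      · exact four 9 (n - 52) (by omega) (by omega) (by omega) (by omega)
      by_cases h3 : n ≤ 256
      · exact five 8 (n - 60) (by omega) (by omega) (by omega) (by omega)
      by_cases h4 : n ≤ 267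
      · exact four 10 (n - 52) (by omega) (by omega) (by omega) (by omega)
      · exact five 9 (n - 60) (by omega) (by omega) (by omega) (by omega)
    · by_cases h1 : n ≤ 285
      · exact four 10 (n - 54) (by omega) (by omega) (by omega) (by omega)
      by_cases h2 : n ≤ 300
      · exact four 11 (n - 54) (by omega) (by omega) (by omega) (by omega)
      by_cases h3 : n ≤ 315
      · exact five 10 (n - 62) (by omega) (by omega) (by omega) (by omega)
      · exact four 12 (n - 54) (by omega) (by omega) (by omega) (by omega)
    · by_cases h1 : n ≤ 345
      · exact four 12 (n - 56) (by omega) (by omega) (by omega) (by omega)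
      by_cases h2 : n ≤ 360
      · exact four 13 (n - 56) (by omega) (by omega) (by omega) (by omega)
      · exact five 12 (n - 64) (by omega) (by omega) (by omega) (by omega)

end Construction

theorem stmt_19 (n : ℕ) (hn : 230 ≤ n) :
    (n : ℤ) - ⌊Real.sqrt (1 + (n : ℝ) / 2) - 3 / 4⌋ < ((fibRunGraph n).diam : ℤ) := by
  have hn' : (230 : ℝ) ≤ n := by exact_mod_cast hn
  have hsq : Real.sqrt (1 + (n : ℝ) / 2) ^ 2 = 1 + (n : ℝ) / 2 := Real.sq_sqrt (by positivity)
  have hroot : (10 : ℝ) + 3 / 4 ≤ Real.sqrt (1 + (n : ℝ) / 2) :=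
    Real.le_sqrt_of_sq_le (by linarith)
  obtain ⟨m, hm⟩ : ∃ m : ℕ, ⌊Real.sqrt (1 + (n : ℝ) / 2) - 3 / 4⌋ = m :=
    Int.eq_ofNat_of_zero_le (Int.floor_nonneg.2 (by linarith))
  have hm10 : (10 : ℤ) ≤ m := hm ▸ Int.le_floor.2 (by push_cast; linarith)
  obtain ⟨h1, h2⟩ := Int.floor_eq_iff.1 hm
  push_cast at h1 h2
  have hlo : 2 * m ^ 2 + 3 * m ≤ n := by
    have : (2 * m ^ 2 + 3 * m : ℝ) < n + 1 := by nlinarith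
    exact Nat.lt_succ_iff.1 (by exact_mod_cast this)
  have hhi : n ≤ 2 * m ^ 2 + 7 * m + 4 := by
    have : (n : ℝ) < 2 * m ^ 2 + 7 * m + 4 + 1 := by nlinarith
    exact Nat.lt_succ_iff.1 (by exact_mod_cast this)
  have := lt_diam_add (by exact_mod_cast hm10) hlo hhi
  rw [hm]
  omega
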